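/- Let ε ∈ (0,1/4], let D = D¹ × ⋯ × Dⁿ be a product Borel probability distribution on [0,∞)ⁿ in which every Dⁱ is regular, and let v̄ ≥ (1/ε)·Opt(D). For each i let D̄ⁱ be the pushforward of Dⁱ under v ↦ min(v, v̄) (truncation at v̄). Then Opt(D̄¹ × ⋯ × D̄ⁿ) ≥ (1 − 4ε)·Opt(D). -/

import Mathlib

open MeasureTheory

/-- A (direct-revelation) mechanism for `n` buyers and one item: an allocation
rule and a payment rule on value profiles. -/
structure Mech (n : ℕ) where
  alloc : (Fin n → ℝ) → Fin n → ℝ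
  pay : (Fin n → ℝ) → Fin n → ℝ

/-- Allocation probabilities are in `[0,1]` and sum to at most `1`. -/
def Mech.Valid {n : ℕ} (M : Mech n) : Prop :=
  ∀ v : Fin n → ℝ, (∀ i, 0 ≤ M.alloc v i ∧ M.alloc v i ≤ 1) ∧ ∑ i, M.alloc v i ≤ 1

/-- Dominant strategy incentive compatibility (on nonnegative value profiles). -/
def Mech.DSIC {n : ℕ} (M : Mech n) : Prop :=
  ∀ (i : Fin n) (v : Fin n → ℝ), (∀ j, 0 ≤ v j) → ∀ v' : ℝ, 0 ≤ v' →
    v i * M.alloc (Function.update v i v') i - M.pay (Function.update v i v') i ≤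
      v i * M.alloc v i - M.pay v i

/-- Individual rationality (on nonnegative value profiles). -/
def Mech.IR {n : ℕ} (M : Mech n) : Prop :=
  ∀ v : Fin n → ℝ, (∀ j, 0 ≤ v j) → ∀ i, 0 ≤ v i * M.alloc v i - M.pay v i

/-- Measurability of the allocation and payment rules. -/
def Mech.Meas {n : ℕ} (M : Mech n) : Prop :=
  (∀ i, Measurable fun v => M.alloc v i) ∧ (∀ i, Measurable fun v => M.pay v i)

/-- A measurable DSIC and IR mechanism. -/
def Mech.Good {n : ℕ} (M : Mech n) : Prop := M.Valid ∧ M.DSIC ∧ M.IR ∧ M.Meas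

/-- Expected revenue of mechanism `M` on value distribution `D`. -/
noncomputable def Rev {n : ℕ} (M : Mech n) (D : Measure (Fin n → ℝ)) : ℝ :=
  ∫ v, ∑ i, M.pay v i ∂D

/-- Optimal revenue: supremum of revenue over measurable DSIC and IR mechanisms. -/
noncomputable def Opt {n : ℕ} (D : Measure (Fin n → ℝ)) : ℝ :=
  sSup {r : ℝ | ∃ M : Mech n, M.Good ∧ r = Rev M D}


/-- The value at quantile `q`: `v(q) = inf {t ≥ 0 : F(t) ≥ 1-q}` where `F` is
the CDF of `D`. -/
noncomputable def qval (D : Measure ℝ) (q : ℝ) : ℝ :=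
  sInf {t : ℝ | 0 ≤ t ∧ ENNReal.ofReal (1 - q) ≤ D (Set.Iic t)}

/-- A distribution on `[0,∞)` is regular if its revenue curve in quantile
space, `R(q) = q·v(q)`, is concave on `[0,1]`. -/
def Regular (D : Measure ℝ) : Prop :=
  ConcaveOn ℝ (Set.Icc (0 : ℝ) 1) (fun q => q * qval D q)

lemma ic_mono {x p : ℝ → ℝ} (hic : ∀ t s, 0 ≤ t → 0 ≤ s → t * x s - p s ≤ t * x t - p t)
    {a b : ℝ} (ha : 0 ≤ a) (hab : a ≤ b) : x a ≤ x b := by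
  rcases hab.eq_or_lt with rfl | h
  · exact le_rfl
  · have h1 := hic a b ha (ha.trans hab)
    have h2 := hic b a (ha.trans hab) ha
    nlinarith

lemma dsic_line {n : ℕ} {M : Mech n} (hM : M.DSIC) (i : Fin n) (v : Fin n → ℝ)
    (hv : ∀ j, 0 ≤ v j) (t s : ℝ) (ht : 0 ≤ t) (hs : 0 ≤ s) :
    t * M.alloc (Function.update v i s) i - M.pay (Function.update v i s) i ≤
      t * M.alloc (Function.update v i t) i - M.pay (Function.update v i t) i := by
  have := hM i (Function.update v i t) (by
    intro j
    by_cases h : j = i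
    · subst h; simpa using ht
    · simpa [h] using hv j) s hs
  simpa using this

def cl (T t : ℝ) : ℝ := max 0 (min t T)

lemma cl_nonneg (T t : ℝ) : 0 ≤ cl T t := le_max_left _ _

lemma cl_of (T t : ℝ) (h0 : 0 ≤ t) (h : t ≤ T) : cl T t = t := by
  simp [cl, h0, h]

lemma cl_ge (T t : ℝ) (h0 : 0 ≤ T) (h : T ≤ t) : cl T t = T := by
  simp [cl, h0, h]

def clv {n : ℕ} (T : ℝ) (v : Fin n → ℝ) : Fin n → ℝ := fun j => cl T (v j)

lemma clv_update {n : ℕ} (T : ℝ) (v : Fin n → ℝ) (i : Fin n) (t : ℝ) :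
    clv T (Function.update v i t) = Function.update (clv T v) i (cl T t) := by
  funext j
  by_cases h : j = i
  · subst h; simp [clv]
  · simp [clv, h]

lemma measurable_clv {n : ℕ} (T : ℝ) : Measurable (clv (n := n) T) := by
  unfold clv cl; fun_prop

lemma measurable_upd {n : ℕ} (i : Fin n) (t : ℝ) :
    Measurable (fun v : Fin n → ℝ => Function.update v i t) := by
  refine measurable_pi_iff.2 fun j => ?_
  by_cases h : j = i
  · subst h; simp
  · simp only [Function.update_of_ne h]; fun_prop

/-- normalised and clamped mechanism -/
def clampM {n : ℕ} (M : Mech n) (T : ℝ) : Mech n where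
  alloc v i := M.alloc (clv T v) i
  pay v i := M.pay (clv T v) i - M.pay (Function.update (clv T v) i 0) i

structure Nice {n : ℕ} (M : Mech n) (T : ℝ) : Prop where
  good : M.Good
  nonneg : ∀ v i, 0 ≤ M.pay v i
  le : ∀ v i, M.pay v i ≤ T

lemma clamp_cap {n : ℕ} (M : Mech n) (T : ℝ) (hT : 0 ≤ T) (v : Fin n → ℝ) (i : Fin n)
    (t : ℝ) (ht : T ≤ t) : (clampM M T).pay (Function.update v i t) i =
      (clampM M T).pay (Function.update v i T) i := by
  simp only [clampM, clv_update, cl_ge T t hT ht, cl_ge T T hT le_rfl]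

lemma clamp_nice {n : ℕ} {M : Mech n} (hM : M.Good) (T : ℝ) (hT : 0 ≤ T) :
    Nice (clampM M T) T := by
  obtain ⟨hV, hD, hI, hm⟩ := hM
  have h0 : ∀ v : Fin n → ℝ, ∀ j, 0 ≤ clv T v j := fun v j => cl_nonneg _ _
  have hline := fun (v : Fin n → ℝ) i => dsic_line hD i (clv T v) (h0 v)
  have hself : ∀ (v : Fin n → ℝ) i, Function.update (clv T v) i (cl T (v i)) = clv T v := by
    intro v i; exact Function.update_eq_self i (clv T v)
  have hir0 : ∀ (v : Fin n → ℝ) i, M.pay (Function.update (clv T v) i 0) i ≤ 0 := by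
    intro v i
    have := hI (Function.update (clv T v) i 0) (by
      intro j
      by_cases h : j = i
      · subst h; simp
      · simpa [h] using h0 v j) i
    simpa using this
  have hpn : ∀ (v : Fin n → ℝ) i, 0 ≤ (clampM M T).pay v i := by
    intro v i
    have := hline v i 0 (cl T (v i)) le_rfl (cl_nonneg _ _)
    rw [hself] at this
    simp only [clampM]; linarith
  have hir : ∀ (v : Fin n → ℝ) i,
      (clampM M T).pay v i ≤ cl T (v i) * (clampM M T).alloc v i := by
    intro v i
    have := hline v i (cl T (v i)) 0 (cl_nonneg _ _) le_rfl
    rw [hself] at this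
    have h2 := mul_nonneg (cl_nonneg T (v i)) ((hV (Function.update (clv T v) i 0)).1 i).1
    simp only [clampM]; linarith
  refine ⟨⟨fun v => hV _, ?_, ?_, ?_, ?_⟩, hpn, ?_⟩
  · intro i v hv s hs
    simp only [clampM, clv_update, Function.update_idem]
    have h1 := hline v i (cl T (v i)) (cl T s) (cl_nonneg _ _) (cl_nonneg _ _)
    rw [hself] at h1
    rcases le_total (v i) T with h | h
    · rw [cl_of _ _ (hv i) h] at h1
      linarith
    · have hT' := cl_ge T (v i) hT h
      rw [hT'] at h1
      have h2 := ic_mono (x := fun t => M.alloc (Function.update (clv T v) i t) i)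
        (p := fun t => M.pay (Function.update (clv T v) i t) i) (fun t s => hline v i t s)
        (cl_nonneg T s) (b := T) (by simp [cl, hT])
      have h3 := hself v i
      rw [hT'] at h3
      simp only [h3] at h2
      nlinarith
  · intro v hv i
    have h1 := hir v i
    have h2 : cl T (v i) ≤ v i := by simp [cl, hv i]
    have h3 := mul_le_mul_of_nonneg_right h2 ((hV (clv T v)).1 i).1
    change _ ≤ _ * _ at h1
    simp only [clampM] at *; linarith
  · intro i
    exact (hm.1 i).comp (measurable_clv T)
  · intro i
    exact ((hm.2 i).comp (measurable_clv T)).sub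
      ((hm.2 i).comp ((measurable_upd i 0).comp (measurable_clv T)))
  · intro v i
    refine (hir v i).trans ?_
    have h2 : cl T (v i) ≤ T := by simp [cl, hT]
    have h3 := (hV (clv T v)).1 i
    have h4 := cl_nonneg T (v i)
    simp only [clampM]
    nlinarith

lemma tail_aux (x p : ℝ → ℝ) (t : ℕ → ℝ) (ht0 : ∀ k, 0 ≤ t k) (htm : Monotone t)
    (hx : ∀ a b, t 0 ≤ a → a ≤ b → x a ≤ x b)
    (hp : ∀ a b, t 0 ≤ a → a ≤ b → p b - p a ≤ b * (x b - x a)) (N : ℕ) :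
    ∀ v, t 0 ≤ v → v ≤ t N → p v - p (t 0) ≤
      ∑ k ∈ Finset.range N, (Set.Ici (t k)).indicator
        (fun _ => t (k+1) * (x (t (k+1)) - x (t k))) v := by
  have hnn : ∀ k, 0 ≤ t (k+1) * (x (t (k+1)) - x (t k)) := fun k =>
    mul_nonneg (ht0 _) (sub_nonneg.2 (hx _ _ (htm (Nat.zero_le k)) (htm (Nat.le_succ k))))
  induction N with
  | zero => intro v h1 h2; simp [le_antisymm h2 h1]
  | succ N ih =>
    intro v h1 h2
    rw [Finset.sum_range_succ]
    rcases le_or_gt v (t N) with h | h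
    · have := ih v h1 h
      have h3 : 0 ≤ (Set.Ici (t N)).indicator
        (fun _ => t (N+1) * (x (t (N+1)) - x (t N))) v :=
        Set.indicator_nonneg (fun _ _ => hnn N) _
      linarith
    · have h3 := ih (t N) (htm (Nat.zero_le N)) le_rfl
      have h4 : ∑ k ∈ Finset.range N, (Set.Ici (t k)).indicator
          (fun _ => t (k+1) * (x (t (k+1)) - x (t k))) (t N) =
          ∑ k ∈ Finset.range N, (Set.Ici (t k)).indicator
          (fun _ => t (k+1) * (x (t (k+1)) - x (t k))) v := by
        refine Finset.sum_congr rfl fun k hk => ?_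
        have h5 : t k ≤ t N := htm (Finset.mem_range.1 hk).le
        rw [Set.indicator_of_mem (Set.mem_Ici.2 h5), Set.indicator_of_mem
          (Set.mem_Ici.2 (h5.trans h.le))]
      rw [Set.indicator_of_mem (Set.mem_Ici.2 h.le)]
      have h6 := hp (t N) v (htm (Nat.zero_le N)) h.le
      have h7 := hx v (t (N+1)) h1 h2
      have h8 := hx (t N) v (htm (Nat.zero_le N)) h.le
      have h9 : v * (x v - x (t N)) ≤ t (N+1) * (x (t (N+1)) - x (t N)) :=
        mul_le_mul h2 (by linarith) (by linarith) (ht0 _)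
      linarith

lemma tail_bound (μ : Measure ℝ) [IsProbabilityMeasure μ] (x p : ℝ → ℝ) (w T S C : ℝ)
    (hw : 0 < w)
    (hx : ∀ a b, w ≤ a → a ≤ b → x a ≤ x b) (hx1 : ∀ a, x a ≤ 1)
    (hp : ∀ a b, w ≤ a → a ≤ b → p b - p a ≤ b * (x b - x a))
    (hcap : ∀ a, T ≤ a → p a = p T)
    (hpm : Measurable p) (hpC : ∀ a, |p a| ≤ C)
    (hS : ∀ τ, w ≤ τ → τ * μ.real (Set.Ici τ) ≤ S) :
    ∫ v, (Set.Ici w).indicator (fun v => p v - p w) v ∂μ ≤ (1 - x w) * S := by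
  have hS0 : 0 ≤ S := le_trans (mul_nonneg hw.le measureReal_nonneg) (hS w le_rfl)
  have key : ∀ r : ℝ, 1 < r →
      ∫ v, (Set.Ici w).indicator (fun v => p v - p w) v ∂μ ≤ r * ((1 - x w) * S) := by
    intro r hr
    set t : ℕ → ℝ := fun k => w * r ^ k with htdef
    have ht00 : t 0 = w := by simp [htdef]
    have ht0 : ∀ k, 0 ≤ t k := fun k => by positivity
    have htm : Monotone t := fun a b hab => by
      simp only [htdef]; gcongr; exact hr.le
    obtain ⟨N, hN⟩ : ∃ N, T ≤ t N := by
      obtain ⟨N, hN⟩ := pow_unbounded_of_one_lt (T / w) hr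
      exact ⟨N, by rw [div_lt_iff₀ hw] at hN; simp only [htdef]; linarith⟩
    have haux := tail_aux x p t ht0 htm (by rwa [ht00]) (by rwa [ht00]) N
    have hdx : ∀ k, 0 ≤ x (t (k+1)) - x (t k) := fun k =>
      (sub_nonneg.2 (hx _ _ (ht00 ▸ htm (Nat.zero_le k)) (htm (Nat.le_succ k))))
    have hnn : ∀ k, 0 ≤ t (k+1) * (x (t (k+1)) - x (t k)) := fun k =>
      mul_nonneg (ht0 _) (hdx k)
    have hpt : ∀ v, (Set.Ici w).indicator (fun v => p v - p w) v ≤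
        ∑ k ∈ Finset.range N, (Set.Ici (t k)).indicator
          (fun _ => t (k+1) * (x (t (k+1)) - x (t k))) v := by
      intro v
      by_cases hv : w ≤ v
      · rw [Set.indicator_of_mem (Set.mem_Ici.2 hv)]
        rcases le_total v (t N) with h | h
        · have := haux v (by rwa [ht00]) h
          rwa [ht00] at this
        · have h1 := haux (t N) (htm (Nat.zero_le N)) le_rfl
          have h2 : p v = p (t N) := by rw [hcap v (hN.trans h), hcap _ hN]
          rw [h2]
          rw [ht00] at h1
          refine h1.trans (Finset.sum_le_sum fun k hk => ?_)
          have h5 : t k ≤ t N := htm (Finset.mem_range.1 hk).le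
          rw [Set.indicator_of_mem (Set.mem_Ici.2 h5), Set.indicator_of_mem
            (Set.mem_Ici.2 (h5.trans h))]
      · rw [Set.indicator_of_notMem (by simpa using hv)]
        exact Finset.sum_nonneg fun k _ => Set.indicator_nonneg (fun _ _ => hnn k) _
    have hintg : ∀ k, Integrable ((Set.Ici (t k)).indicator
          (fun _ : ℝ => t (k+1) * (x (t (k+1)) - x (t k)))) μ := fun k =>
      (integrable_const _).indicator measurableSet_Ici
    calc ∫ v, (Set.Ici w).indicator (fun v => p v - p w) v ∂μ
        ≤ ∫ v, ∑ k ∈ Finset.range N, (Set.Ici (t k)).indicator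
          (fun _ => t (k+1) * (x (t (k+1)) - x (t k))) v ∂μ := by
          refine integral_mono ?_ (integrable_finsetSum _ fun k _ => hintg k) hpt
          refine Integrable.indicator ?_ measurableSet_Ici
          refine Integrable.of_bound (hpm.sub_const _).aestronglyMeasurable (C + C)
            (Filter.Eventually.of_forall fun a => ?_)
          exact (abs_sub _ _).trans (add_le_add (hpC a) (hpC w))
      _ = ∑ k ∈ Finset.range N, (t (k+1) * (x (t (k+1)) - x (t k))) * μ.real (Set.Ici (t k)) := by
          rw [integral_finsetSum _ fun k _ => hintg k]
          refine Finset.sum_congr rfl fun k _ => ?_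
          rw [integral_indicator_const _ measurableSet_Ici, smul_eq_mul, mul_comm]
      _ ≤ ∑ k ∈ Finset.range N, r * S * (x (t (k+1)) - x (t k)) := by
          refine Finset.sum_le_sum fun k _ => ?_
          have h1 := hS (t k) (ht00 ▸ htm (Nat.zero_le k))
          have h2 : t (k+1) = r * t k := by simp only [htdef]; ring
          have h3 := mul_le_mul_of_nonneg_left h1 (mul_nonneg (zero_le_one.trans hr.le) (hdx k))
          generalize x (t (k+1)) - x (t k) = d at h3
          rw [h2]
          linarith
      _ = r * S * (x (t N) - x (t 0)) := by
          rw [← Finset.mul_sum, Finset.sum_range_sub (fun k => x (t k))]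
      _ ≤ r * ((1 - x w) * S) := by
          rw [ht00]
          have := mul_le_mul_of_nonneg_left (hx1 (t N)) (mul_nonneg (zero_le_one.trans hr.le) hS0)
          nlinarith
  have hnn : 0 ≤ (1 - x w) * S := mul_nonneg (by linarith [hx1 w]) hS0
  refine le_of_forall_pos_le_add fun δ hδ => ?_
  have h1 := key (1 + δ / ((1 - x w) * S + 1)) (by
    have : 0 < δ / ((1 - x w) * S + 1) := by positivity
    linarith)
  refine h1.trans ?_
  have h2 : δ / ((1 - x w) * S + 1) * ((1 - x w) * S) ≤ δ := by
    rw [div_mul_eq_mul_div, div_le_iff₀ (by positivity)]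
    nlinarith
  linarith

lemma reg_tail (μ : Measure ℝ) [IsProbabilityMeasure μ] (hreg : Regular μ) (w τ : ℝ)
    (hw : 0 ≤ w) (hτ : w ≤ τ) (hq1 : μ.real (Set.Ici w) < 1) :
    τ * μ.real (Set.Ici τ) ≤ w * μ.real (Set.Ici w) / (1 - μ.real (Set.Ici w)) := by
  set q := μ.real (Set.Ici w) with hq
  set s := μ.real (Set.Ici τ) with hs
  have hsq : s ≤ q := measureReal_mono (Set.Ici_subset_Ici.2 hτ)
  have hq0 : 0 ≤ q := measureReal_nonneg
  have hcompl : ∀ a, μ.real (Set.Iio a) = 1 - μ.real (Set.Ici a) := by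
    intro a
    rw [← Set.compl_Ici, probReal_compl_eq_one_sub measurableSet_Ici]
  have hset : ∀ q' : ℝ, q' ≤ 1 → ∀ t, (ENNReal.ofReal (1 - q') ≤ μ (Set.Iic t) ↔
      1 - q' ≤ μ.real (Set.Iic t)) := by
    intro q' hq' t
    exact ENNReal.ofReal_le_iff_le_toReal (measure_ne_top _ _)
  have hvq : qval μ q ≤ w := by
    refine csInf_le ⟨0, fun t ht => ht.1⟩ ⟨hw, ?_⟩
    rw [hset q hq1.le, ← hcompl]
    exact measureReal_mono Set.Iio_subset_Iic_self
  have hvs : ∀ q', 0 < q' → q' < s → τ ≤ qval μ q' := by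
    intro q' h0 hlt
    refine le_csInf ?_ ?_
    · have h1 := tendsto_measure_Iic_atTop μ
      have h2 : ENNReal.ofReal (1 - q') < μ Set.univ := by
        rw [measure_univ, ENNReal.ofReal_lt_one]; linarith
      have h3 := (h1.eventually (lt_mem_nhds h2)).and (Filter.eventually_ge_atTop 0)
      obtain ⟨t, ht⟩ := h3.exists
      exact ⟨t, ht.2, ht.1.le⟩
    · rintro t ⟨ht0, ht⟩
      rw [hset q' (by linarith)] at ht
      by_contra hlt'
      push Not at hlt'
      have h1 : μ.real (Set.Iic t) ≤ μ.real (Set.Iio τ) :=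
        measureReal_mono (Set.Iic_subset_Iio.2 hlt')
      rw [hcompl] at h1
      linarith
  have hv1 : 0 ≤ qval μ 1 := Real.sInf_nonneg fun t ht => ht.1
  rw [le_div_iff₀ (by linarith)]
  have hs0 : 0 ≤ s := measureReal_nonneg
  have hτ0 : 0 ≤ τ := hw.trans hτ
  have main : ∀ q', 0 < q' → q' < s → τ * q' * (1 - q) ≤ w * q := by
    intro q' h0 hlt
    have hlt1 : q' < q := hlt.trans_le hsq
    have hd : 0 < 1 - q' := by linarith
    have hc := (show ConcaveOn ℝ (Set.Icc (0:ℝ) 1) (fun q => q * qval μ q) from hreg).2 (show q' ∈ Set.Icc (0:ℝ) 1 from ⟨h0.le, by linarith⟩)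
      (show (1:ℝ) ∈ Set.Icc (0:ℝ) 1 from ⟨zero_le_one, le_rfl⟩)
      (show 0 ≤ (1 - q) / (1 - q') from div_nonneg (by linarith) hd.le)
      (show 0 ≤ (q - q') / (1 - q') from div_nonneg (by linarith) hd.le)
      (by field_simp; ring)
    have he : (1 - q) / (1 - q') * q' + (q - q') / (1 - q') * 1 = q := by
      field_simp; ring
    simp only [smul_eq_mul] at hc
    rw [he] at hc
    have h1 : 0 ≤ (q - q') / (1 - q') * (1 * qval μ 1) :=
      mul_nonneg (div_nonneg (by linarith) hd.le) (by linarith)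
    have h2 : q * qval μ q ≤ w * q := by nlinarith
    have h3 : (1 - q) * (q' * τ) ≤ (1 - q) / (1 - q') * (q' * qval μ q') := by
      refine mul_le_mul ?_ ?_ (by positivity) (div_nonneg (by linarith) hd.le)
      · rw [le_div_iff₀ hd]; nlinarith
      · exact mul_le_mul_of_nonneg_left (hvs q' h0 hlt) h0.le
    nlinarith
  rcases hs0.eq_or_lt with h | h
  · rw [← h]; simp; positivity
  · have hcont : Filter.Tendsto (fun q' => τ * q' * (1 - q)) (nhdsWithin s (Set.Iio s))
        (nhds (τ * s * (1 - q))) := by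
      refine Filter.Tendsto.mono_left ?_ nhdsWithin_le_nhds
      exact Continuous.tendsto (by fun_prop) s
    refine le_of_tendsto hcont ?_
    filter_upwards [Ioo_mem_nhdsLT h] with q' hq'
    exact main q' hq'.1 hq'.2

section Product
variable {n : ℕ}

lemma measurable_upd2 (i : Fin n) :
    Measurable (fun z : (Fin n → ℝ) × ℝ => Function.update z.1 i z.2) := by
  refine measurable_pi_iff.2 fun j => ?_
  by_cases h : j = i
  · subst h; simpa using measurable_snd
  · simp only [Function.update_of_ne h]; fun_prop

lemma upd_mp (D : Fin n → Measure ℝ) [∀ i, IsProbabilityMeasure (D i)] (i : Fin n) :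
    MeasurePreserving (fun z : (Fin n → ℝ) × ℝ => Function.update z.1 i z.2)
      ((Measure.pi D).prod (D i)) (Measure.pi D) := by
  refine ⟨measurable_upd2 i, (Measure.pi_eq fun s hs => ?_).symm⟩
  rw [Measure.map_apply (measurable_upd2 i) (MeasurableSet.univ_pi hs)]
  have : (fun z : (Fin n → ℝ) × ℝ => Function.update z.1 i z.2) ⁻¹' (Set.univ.pi s) =
      (Set.univ.pi (Function.update s i Set.univ)) ×ˢ s i := by
    ext z
    simp only [Set.mem_preimage, Set.mem_pi, Set.mem_univ, true_implies, Set.mem_prod]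
    constructor
    · intro h
      refine ⟨fun j => ?_, by simpa using h i⟩
      by_cases hj : j = i
      · subst hj; simp
      · simpa [hj] using h j
    · rintro ⟨h1, h2⟩ j
      by_cases hj : j = i
      · subst hj; simpa using h2
      · simpa [hj] using h1 j
  rw [this, Measure.prod_prod, Measure.pi_pi]
  rw [← Finset.mul_prod_erase Finset.univ _ (Finset.mem_univ i),
    ← Finset.mul_prod_erase Finset.univ (fun j => D j (s j)) (Finset.mem_univ i)]
  simp only [Function.update_self, measure_univ, one_mul]
  rw [mul_comm]
  congr 1
  refine Finset.prod_congr rfl fun j hj => ?_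
  rw [Function.update_of_ne (Finset.ne_of_mem_erase hj)]

variable (D : Fin n → Measure ℝ) [∀ i, IsProbabilityMeasure (D i)]

lemma int_of_bdd {α : Type*} [MeasurableSpace α] (μ : Measure α) [IsProbabilityMeasure μ]
    {f : α → ℝ} (hf : Measurable f) (C : ℝ) (h : ∀ a, |f a| ≤ C) : Integrable f μ :=
  Integrable.of_bound hf.aestronglyMeasurable C (Filter.Eventually.of_forall h)

lemma int_upd (i : Fin n) {f : (Fin n → ℝ) → ℝ} (hf : Measurable f) (C : ℝ)
    (h : ∀ a, |f a| ≤ C) :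
    ∫ v, f v ∂(Measure.pi D) = ∫ v, ∫ t, f (Function.update v i t) ∂(D i) ∂(Measure.pi D) := by
  have h1 := upd_mp D i
  rw [← h1.map_eq, integral_map h1.measurable.aemeasurable hf.aestronglyMeasurable, h1.map_eq]
  exact integral_prod _ (int_of_bdd _ (hf.comp h1.measurable) C fun a => h _)

lemma int_upd' (i : Fin n) {f : (Fin n → ℝ) → ℝ} (hf : Measurable f) (C : ℝ)
    (h : ∀ a, |f a| ≤ C) :
    ∫ v, f v ∂(Measure.pi D) = ∫ t, ∫ v, f (Function.update v i t) ∂(Measure.pi D) ∂(D i) := by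
  have h1 := upd_mp D i
  rw [← h1.map_eq, integral_map h1.measurable.aemeasurable hf.aestronglyMeasurable, h1.map_eq]
  exact integral_prod_symm _ (int_of_bdd _ (hf.comp h1.measurable) C fun a => h _)

lemma intble_upd (i : Fin n) {f : (Fin n → ℝ) → ℝ} (hf : Measurable f) (C : ℝ)
    (h : ∀ a, |f a| ≤ C) :
    Integrable (fun v => ∫ t, f (Function.update v i t) ∂(D i)) (Measure.pi D) :=
  (int_of_bdd _ (hf.comp (measurable_upd2 i)) C fun _ => h _ :
    Integrable _ ((Measure.pi D).prod (D i))).integral_prod_left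

lemma intble_upd' (i : Fin n) {f : (Fin n → ℝ) → ℝ} (hf : Measurable f) (C : ℝ)
    (h : ∀ a, |f a| ≤ C) :
    Integrable (fun t => ∫ v, f (Function.update v i t) ∂(Measure.pi D)) (D i) :=
  (int_of_bdd _ (hf.comp (measurable_upd2 i)) C fun _ => h _ :
    Integrable _ ((Measure.pi D).prod (D i))).integral_prod_right

lemma ae_nonneg' (hnonneg : ∀ i, D i (Set.Iio 0) = 0) :
    ∀ᵐ v ∂(Measure.pi D), ∀ j, 0 ≤ v j := by
  rw [ae_all_iff]
  intro j
  have h : ∀ᵐ t ∂(D j), 0 ≤ t := by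
    rw [ae_iff]; simpa [Set.Iio] using hnonneg j
  exact (Measure.quasiMeasurePreserving_eval D j).ae h

/-- some other buyer is at or above `w` -/
def Bd (w : ℝ) (i : Fin n) (v : Fin n → ℝ) : Prop := ∃ j, j ≠ i ∧ w ≤ v j

lemma Bd_update (w : ℝ) (i : Fin n) (v : Fin n → ℝ) (t : ℝ) :
    Bd w i (Function.update v i t) ↔ Bd w i v := by
  unfold Bd
  refine exists_congr fun j => and_congr_right fun hj => ?_
  rw [Function.update_of_ne hj]

lemma Bd_meas (w : ℝ) (i : Fin n) : MeasurableSet {v : Fin n → ℝ | Bd w i v} := by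
  have : {v : Fin n → ℝ | Bd w i v} = ⋃ j, ⋃ (_ : j ≠ i), {v | w ≤ v j} := by
    ext v; simp [Bd]
  rw [this]
  refine MeasurableSet.iUnion fun j => MeasurableSet.iUnion fun _ => ?_
  exact measurableSet_le measurable_const (measurable_pi_apply j)

open Classical in
noncomputable def barM (M : Mech n) (w : ℝ) : Mech n where
  alloc v i := if Bd w i v then 0 else if w ≤ v i then 1 else M.alloc v i
  pay v i := if Bd w i v then 0 else if w ≤ v i then
    w - w * M.alloc (Function.update v i w) i + M.pay (Function.update v i w) i else M.pay v i

open Classical in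
lemma bar_nice {M : Mech n} {T w : ℝ} (hM : Nice M T) (hw : 0 < w) :
    Nice (barM M w) (w + T) := by
  obtain ⟨⟨hV, hD, hI, hm⟩, hn, hT⟩ := hM
  have hmem : ∀ i : Fin n, MeasurableSet {v : Fin n → ℝ | w ≤ v i} := fun i =>
    measurableSet_le measurable_const (measurable_pi_apply i)
  have hline := fun (i : Fin n) v hv => dsic_line hD i v hv
  refine ⟨⟨?_, ?_, ?_, ?_, ?_⟩, ?_, ?_⟩
  · intro v
    have h1 : ∀ i, 0 ≤ (barM M w).alloc v i ∧ (barM M w).alloc v i ≤ 1 := by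
      intro i
      simp only [barM]
      split_ifs
      · simp
      · simp
      · exact (hV v).1 i
    refine ⟨h1, ?_⟩
    by_cases hk : ∃ k, w ≤ v k
    · obtain ⟨k, hk⟩ := hk
      rw [Finset.sum_eq_single k]
      · exact (h1 k).2
      · intro i _ hi
        have : Bd w i v := ⟨k, hi.symm, hk⟩
        simp [barM, this]
      · simp
    · have : ∀ i, (barM M w).alloc v i = M.alloc v i := by
        intro i
        have h2 : ¬ Bd w i v := fun ⟨j, _, hj⟩ => hk ⟨j, hj⟩
        have h3 : ¬ w ≤ v i := fun h => hk ⟨i, h⟩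
        simp only [barM, if_neg h2, if_neg h3]
      simp only [this]
      exact (hV v).2
  · intro i v hv s hs
    simp only [barM, Bd_update, Function.update_self, Function.update_idem]
    by_cases hB : Bd w i v
    · simp [hB]
    · simp only [if_neg hB]
      have hself : Function.update v i (v i) = v := Function.update_eq_self i v
      have a1 := hline i v hv (v i) s (hv i) hs
      have a2 := hline i v hv (v i) w (hv i) hw.le
      have a3 := hline i v hv w s hw.le hs
      rw [hself] at a1 a2
      have b1 := ((hV (Function.update v i s)).1 i)
      have b2 := ((hV (Function.update v i w)).1 i)
      split_ifs with c1 c2 c2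
      · linarith
      · nlinarith
      · nlinarith
      · linarith
  · intro v hv i
    have hself : Function.update v i (v i) = v := Function.update_eq_self i v
    simp only [barM]
    split_ifs with hB c1
    · simp
    · have h1 := hI (Function.update v i w) (by
        intro j
        by_cases h : j = i
        · subst h; simpa using hw.le
        · simpa [h] using hv j) i
      simp only [Function.update_self] at h1
      linarith
    · exact hI v hv i
  · intro i
    exact Measurable.ite (Bd_meas w i) measurable_const
      (Measurable.ite (hmem i) measurable_const (hm.1 i))
  · intro i
    have g1 := (hm.1 i).comp (measurable_upd i w)
    have g2 := (hm.2 i).comp (measurable_upd i w)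
    exact Measurable.ite (Bd_meas w i) measurable_const
      (Measurable.ite (hmem i) ((measurable_const.sub (g1.const_mul w)).add g2) (hm.2 i))
  · intro v i
    have b2 := ((hV (Function.update v i w)).1 i)
    have b3 := hn (Function.update v i w) i
    have b4 := hn v i
    simp only [barM]
    split_ifs
    · exact le_rfl
    · nlinarith
    · exact b4
  · intro v i
    have b2 := ((hV (Function.update v i w)).1 i)
    have b3 := hT (Function.update v i w) i
    have b4 := hT v i
    have b5 := hn v i
    simp only [barM]
    split_ifs
    · linarith
    · nlinarith
    · linarith

open Classical in
lemma bar_trunc (M : Mech n) (w : ℝ) (v : Fin n → ℝ) (i : Fin n) :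
    (barM M w).pay (fun j => min (v j) w) i = (barM M w).pay v i := by
  have hB : Bd w i (fun j => min (v j) w) ↔ Bd w i v := by
    unfold Bd; simp
  simp only [barM, hB]
  by_cases h : Bd w i v
  · simp [h]
  · simp only [if_neg h]
    have hlt : ∀ j, j ≠ i → v j < w := by
      intro j hj
      by_contra hc
      exact h ⟨j, hj, not_lt.1 hc⟩
    have hu : ∀ t, Function.update (fun j => min (v j) w) i t = Function.update v i t := by
      intro t
      funext j
      by_cases hj : j = i
      · subst hj; simp
      · simp [hj, (hlt j hj).le]
    simp only [hu, le_min_iff, le_refl, and_true]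
    split_ifs with c
    · rfl
    · have h2 : (fun j => min (v j) w) = v := by
        funext j
        by_cases hj : j = i
        · subst hj; exact min_eq_left (not_le.1 c).le
        · exact min_eq_left (hlt j hj).le
      rw [h2]

lemma rev_eq_sum {M : Mech n} {T : ℝ} (hM : Nice M T) :
    Rev M (Measure.pi D) = ∑ i, ∫ v, M.pay v i ∂(Measure.pi D) := by
  unfold Rev
  exact integral_finsetSum _ fun i _ => int_of_bdd _ (hM.good.2.2.2.2 i) T fun v => by
    rw [abs_of_nonneg (hM.nonneg v i)]; exact hM.le v i

lemma rev_trunc {M : Mech n} {T w : ℝ} (hM : Nice M T) (hw : 0 < w) :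
    Rev (barM M w) (Measure.pi fun i => Measure.map (fun v : ℝ => min v w) (D i)) =
      Rev (barM M w) (Measure.pi D) := by
  have hmm : Measurable (fun v : ℝ => min v w) := by fun_prop
  have : ∀ i, IsProbabilityMeasure (Measure.map (fun v : ℝ => min v w) (D i)) := fun i =>
    Measure.isProbabilityMeasure_map hmm.aemeasurable
  rw [← Measure.pi_map_pi (fun i => hmm.aemeasurable)]
  unfold Rev
  rw [integral_map]
  · simp only [bar_trunc]
  · exact Measurable.aemeasurable (by fun_prop)
  · exact (Finset.measurable_sum _ fun i _ =>
      (bar_nice hM hw).good.2.2.2.2 i).aestronglyMeasurable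

open Classical in
lemma step2 (hnonneg : ∀ i, D i (Set.Iio 0) = 0) (hreg : ∀ i, Regular (D i))
    {M : Mech n} {T w : ℝ} (hM : Nice M T) (hw : 0 < w)
    (hcap : ∀ v i t, T ≤ t → M.pay (Function.update v i t) i = M.pay (Function.update v i T) i)
    (i : Fin n) (hq : (D i).real (Set.Ici w) < 1) :
    ∫ v, (if Bd w i v then 0 else M.pay v i) ∂(Measure.pi D) ≤
      ∫ v, (barM M w).pay v i ∂(Measure.pi D) +
        (w * (D i).real (Set.Ici w) / (1 - (D i).real (Set.Ici w)) - w * (D i).real (Set.Ici w)) := by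
  set q := (D i).real (Set.Ici w) with hqdef
  have hq0 : 0 ≤ q := measureReal_nonneg
  have hT0 : ∀ v i, |M.pay v i| ≤ T := fun v i => by
    rw [abs_of_nonneg (hM.nonneg v i)]; exact hM.le v i
  have hbar := bar_nice hM hw
  have hT1 : ∀ v i, |(barM M w).pay v i| ≤ w + T := fun v i => by
    rw [abs_of_nonneg (hbar.nonneg v i)]; exact hbar.le v i
  have hc0 : 0 ≤ w * q / (1 - q) - w * q := by
    rw [sub_nonneg, le_div_iff₀ (by linarith)]
    have : 0 ≤ w * q := by positivity
    nlinarith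
  set c := w * q / (1 - q) - w * q with hc
  have hfm : Measurable (fun v => if Bd w i v then 0 else M.pay v i) :=
    Measurable.ite (Bd_meas w i) measurable_const (hM.good.2.2.2.2 i)
  have hfb : ∀ v, |(if Bd w i v then 0 else M.pay v i)| ≤ T := by
    intro v
    split_ifs
    · simpa using (abs_nonneg _).trans (hT0 v i)
    · exact hT0 v i
  have hgm := hbar.good.2.2.2.2 i
  rw [int_upd D i hfm T hfb, int_upd D i hgm _ (fun v => hT1 v i)]
  have : ∫ v, ∫ t, (barM M w).pay (Function.update v i t) i ∂(D i) ∂(Measure.pi D) + c =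
      ∫ v, (∫ t, (barM M w).pay (Function.update v i t) i ∂(D i) + c) ∂(Measure.pi D) := by
    rw [integral_add (intble_upd D i hgm _ (fun v => hT1 v i)) (integrable_const _)]
    simp
  rw [this]
  refine integral_mono_ae (intble_upd D i hfm T hfb)
    ((intble_upd D i hgm _ (fun v => hT1 v i)).add (integrable_const _)) ?_
  filter_upwards [ae_nonneg' D hnonneg] with v hv
  simp only [Bd_update]
  by_cases hB : Bd w i v
  · simp [barM, Bd_update, hB, hc0]
  · simp only [if_neg hB]
    set X : ℝ → ℝ := fun t => M.alloc (Function.update v i t) i with hX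
    set P : ℝ → ℝ := fun t => M.pay (Function.update v i t) i with hP
    have hPm : Measurable P := (hM.good.2.2.2.2 i).comp (measurable_update v)
    have hbm : Measurable (fun t => (barM M w).pay (Function.update v i t) i) :=
      hgm.comp (measurable_update v)
    have hic : ∀ t s, 0 ≤ t → 0 ≤ s → t * X s - P s ≤ t * X t - P t :=
      fun t s => dsic_line hM.good.2.1 i v hv t s
    have htail := tail_bound (D i) X P w T (w * q / (1 - q)) T hw
      (fun a b ha hab => ic_mono hic (hw.le.trans ha) hab)
      (fun a => ((hM.good.1 _).1 i).2)
      (fun a b ha hab => by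
        have := hic b a (hw.le.trans (ha.trans hab)) (hw.le.trans ha)
        linarith)
      (fun a ha => hcap v i a ha) hPm (fun a => hT0 _ i)
      (fun τ hτ => reg_tail (D i) (hreg i) w τ hw.le hτ hq)
    have hdec : ∀ t, P t = (barM M w).pay (Function.update v i t) i +
        ((Set.Ici w).indicator (fun t => P t - P w) t -
          (Set.Ici w).indicator (fun _ => w * (1 - X w)) t) := by
      intro t
      simp only [barM, Bd_update, if_neg hB, Function.update_self, Function.update_idem]
      by_cases ht : w ≤ t
      · rw [if_pos ht, Set.indicator_of_mem (Set.mem_Ici.2 ht),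
          Set.indicator_of_mem (Set.mem_Ici.2 ht)]
        ring
      · rw [if_neg ht, Set.indicator_of_notMem (by simpa using ht),
          Set.indicator_of_notMem (by simpa using ht)]
        ring
    have i1 : Integrable (fun t => (barM M w).pay (Function.update v i t) i) (D i) :=
      int_of_bdd _ hbm _ (fun t => hT1 _ i)
    have i2 : Integrable ((Set.Ici w).indicator (fun t => P t - P w)) (D i) :=
      ((int_of_bdd _ hPm T (fun t => hT0 _ i)).sub (integrable_const _)).indicator
        measurableSet_Ici
    have i3 : Integrable ((Set.Ici w).indicator (fun _ : ℝ => w * (1 - X w))) (D i) :=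
      (integrable_const _).indicator measurableSet_Ici
    have e : ∫ t, P t ∂(D i) = ∫ t, (barM M w).pay (Function.update v i t) i ∂(D i) +
        (∫ t, (Set.Ici w).indicator (fun t => P t - P w) t ∂(D i) - q * (w * (1 - X w))) := by
      have e3 : ∫ t, (Set.Ici w).indicator (fun _ : ℝ => w * (1 - X w)) t ∂(D i) =
          q * (w * (1 - X w)) := by
        rw [integral_indicator_const _ measurableSet_Ici, smul_eq_mul]
      rw [← e3, ← integral_sub i2 i3]
      have e4 := integral_add i1 (i2.sub i3)
      simp only [Pi.sub_apply] at e4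
      rw [← e4]
      exact integral_congr_ae (Filter.Eventually.of_forall hdec)
    rw [e]
    have hX0 : 0 ≤ X w := ((hM.good.1 _).1 i).1
    have : (1 - X w) * (w * q / (1 - q)) - q * (w * (1 - X w)) = (1 - X w) * c := by
      rw [hc]; ring
    have h5 : (1 - X w) * c ≤ c := by nlinarith
    linarith

end Product

section Final
variable {n : ℕ}

/-- fix the report of `j` to `t` and exclude `j` -/
def fixM (M : Mech n) (j : Fin n) (t : ℝ) : Mech n where
  alloc v i := if i = j then 0 else M.alloc (Function.update v j t) i
  pay v i := if i = j then 0 else M.pay (Function.update v j t) i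

lemma upd_nonneg {v : Fin n → ℝ} (hv : ∀ j, 0 ≤ v j) (j : Fin n) {t : ℝ} (ht : 0 ≤ t) :
    ∀ k, 0 ≤ Function.update v j t k := by
  intro k
  by_cases h : k = j
  · subst h; simpa using ht
  · simpa [h] using hv k

lemma fix_good {M : Mech n} (hM : M.Good) (j : Fin n) {t : ℝ} (ht : 0 ≤ t) :
    (fixM M j t).Good := by
  obtain ⟨hV, hD, hI, hm⟩ := hM
  refine ⟨?_, ?_, ?_, ?_, ?_⟩
  · intro v
    obtain ⟨h1, h2⟩ := hV (Function.update v j t)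
    refine ⟨?_, le_trans (Finset.sum_le_sum ?_) h2⟩
    · intro i
      simp only [fixM]
      split_ifs
      · simp
      · exact h1 i
    · intro i _
      simp only [fixM]
      split_ifs
      · exact (h1 i).1
      · exact le_rfl
  · intro i v hv s hs
    by_cases h : i = j
    · simp [fixM, h]
    · simp only [fixM, if_neg h]
      have := hD i (Function.update v j t) (upd_nonneg hv j ht) s hs
      rw [Function.update_of_ne h] at this
      rw [Function.update_comm (Ne.symm h)] at this
      exact this
  · intro v hv i
    by_cases h : i = j
    · simp [fixM, h]
    · simp only [fixM, if_neg h]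
      have := hI (Function.update v j t) (upd_nonneg hv j ht) i
      rwa [Function.update_of_ne h] at this
  · intro i
    by_cases h : i = j
    · simp [fixM, h]
    · simp only [fixM, if_neg h]
      exact (hm.1 i).comp (measurable_upd j t)
  · intro i
    by_cases h : i = j
    · simp [fixM, h]
    · simp only [fixM, if_neg h]
      exact (hm.2 i).comp (measurable_upd j t)

variable (D : Fin n → Measure ℝ) [∀ i, IsProbabilityMeasure (D i)]

open Classical in
lemma step1 {M : Mech n} {T w O : ℝ} (hM : Nice M T) (hw : 0 < w)
    (hO : ∀ M : Mech n, M.Good → Rev M (Measure.pi D) ≤ O) :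
    ∑ i, ∫ v, (if Bd w i v then M.pay v i else 0) ∂(Measure.pi D) ≤
      (∑ j, (D j).real (Set.Ici w)) * O := by
  have hT0 : ∀ v i, |M.pay v i| ≤ T := fun v i => by
    rw [abs_of_nonneg (hM.nonneg v i)]; exact hM.le v i
  have hpm := hM.good.2.2.2.2
  set g : Fin n → (Fin n → ℝ) → ℝ := fun j v =>
    if w ≤ v j then ∑ i, (if i = j then 0 else M.pay v i) else 0 with hg
  have hsm : ∀ j, Measurable (fun v => ∑ i, (if i = j then 0 else M.pay v i)) := by
    intro j
    refine Finset.measurable_sum _ fun i _ => ?_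
    by_cases h : i = j
    · simp [h]
    · simpa [h] using hpm i
  have hgm : ∀ j, Measurable (g j) := fun j =>
    Measurable.ite (measurableSet_le measurable_const (measurable_pi_apply j)) (hsm j)
      measurable_const
  have hterm : ∀ v i j, 0 ≤ (if i = j then 0 else M.pay v i) := by
    intro v i j
    split_ifs
    · exact le_rfl
    · exact hM.nonneg v i
  have hgn : ∀ j v, 0 ≤ g j v := by
    intro j v
    simp only [hg]
    split_ifs
    · exact Finset.sum_nonneg fun i _ => hterm v i j
    · exact le_rfl
  have hgb : ∀ j v, |g j v| ≤ ∑ _i : Fin n, T := by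
    intro j v
    rw [abs_of_nonneg (hgn j v)]
    simp only [hg]
    have hT : ∀ i : Fin n, 0 ≤ T := fun i => (abs_nonneg _).trans (hT0 v i)
    split_ifs
    · refine Finset.sum_le_sum fun i _ => ?_
      split_ifs
      · exact hT i
      · exact hM.le v i
    · exact Finset.sum_nonneg fun i _ => hT i
  have hfi : ∀ i, Integrable (fun v => if Bd w i v then M.pay v i else 0) (Measure.pi D) := by
    intro i
    refine int_of_bdd _ (Measurable.ite (Bd_meas w i) (hpm i) measurable_const) T fun v => ?_
    split_ifs
    · exact hT0 v i
    · simpa using (abs_nonneg _).trans (hT0 v i)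
  rw [← integral_finsetSum _ fun i _ => hfi i]
  calc ∫ v, ∑ i, (if Bd w i v then M.pay v i else 0) ∂(Measure.pi D)
      ≤ ∫ v, ∑ j, g j v ∂(Measure.pi D) := by
        refine integral_mono (integrable_finsetSum _ fun i _ => hfi i)
          (integrable_finsetSum _ fun j _ => int_of_bdd _ (hgm j) _ (hgb j)) fun v => ?_
        have e : ∑ j, g j v = ∑ i, ∑ j, if w ≤ v j then (if i = j then 0 else M.pay v i) else 0 := by
          rw [Finset.sum_comm]
          refine Finset.sum_congr rfl fun j _ => ?_
          simp only [hg]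
          split_ifs
          · rfl
          · simp
        simp only [e]
        have hnn : ∀ i j, 0 ≤ if w ≤ v j then (if i = j then 0 else M.pay v i) else 0 := by
          intro i j
          split_ifs
          · exact le_rfl
          · exact hM.nonneg v i
          · exact le_rfl
        refine Finset.sum_le_sum fun i _ => ?_
        by_cases hB : Bd w i v
        · rw [if_pos hB]
          obtain ⟨j, hj, hj2⟩ := hB
          refine le_trans ?_ (Finset.single_le_sum (fun j _ => hnn i j) (Finset.mem_univ j))
          rw [if_pos hj2, if_neg hj.symm]
        · rw [if_neg hB]
          exact Finset.sum_nonneg fun j _ => hnn i j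
    _ = ∑ j, ∫ v, g j v ∂(Measure.pi D) :=
        integral_finsetSum _ fun j _ => int_of_bdd _ (hgm j) _ (hgb j)
    _ ≤ ∑ j, (D j).real (Set.Ici w) * O := by
        refine Finset.sum_le_sum fun j _ => ?_
        rw [int_upd' D j (hgm j) _ (hgb j)]
        have e : (D j).real (Set.Ici w) * O = ∫ t, (Set.Ici w).indicator (fun _ => O) t ∂(D j) := by
          rw [integral_indicator_const _ measurableSet_Ici, smul_eq_mul]
        rw [e]
        refine integral_mono (intble_upd' D j (hgm j) _ (hgb j))
          ((integrable_const _).indicator measurableSet_Ici) fun t => ?_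
        by_cases ht : w ≤ t
        · rw [Set.indicator_of_mem (Set.mem_Ici.2 ht)]
          have := hO _ (fix_good hM.good j (hw.le.trans ht))
          simpa [hg, ht, Rev, fixM] using this
        · rw [Set.indicator_of_notMem (by simpa using ht)]
          simp [hg, ht]
    _ = _ := by rw [Finset.sum_mul]

open Classical in
/-- sequential posting of price `w` -/
noncomputable def postM (n : ℕ) (w : ℝ) : Mech n where
  alloc v i := if w ≤ v i ∧ ∀ j, j < i → v j < w then 1 else 0
  pay v i := if w ≤ v i ∧ ∀ j, j < i → v j < w then w else 0

def PreLow (w : ℝ) (i : Fin n) : Set (Fin n → ℝ) := {v | ∀ j, j < i → v j < w}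

lemma preLow_meas (w : ℝ) (i : Fin n) : MeasurableSet (PreLow w i) := by
  have : PreLow w i = ⋂ j, ⋂ (_ : j < i), {v | v j < w} := by
    ext v; simp [PreLow]
  rw [this]
  refine MeasurableSet.iInter fun j => MeasurableSet.iInter fun _ => ?_
  exact measurableSet_lt (measurable_pi_apply j) measurable_const

lemma post_set_meas (w : ℝ) (i : Fin n) :
    MeasurableSet {v : Fin n → ℝ | w ≤ v i ∧ ∀ j, j < i → v j < w} :=
  (measurableSet_le measurable_const (measurable_pi_apply i)).inter (preLow_meas w i)

open Classical in
lemma post_upd (w : ℝ) (i : Fin n) (v : Fin n → ℝ) (t : ℝ) :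
    (∀ j, j < i → Function.update v i t j < w) ↔ ∀ j, j < i → v j < w := by
  refine forall_congr' fun j => forall_congr' fun hj => ?_
  rw [Function.update_of_ne hj.ne]

open Classical in
lemma post_nice (w : ℝ) (hw : 0 < w) : Nice (postM n w) w := by
  refine ⟨⟨?_, ?_, ?_, ?_, ?_⟩, ?_, ?_⟩
  · intro v
    have h1 : ∀ i, 0 ≤ (postM n w).alloc v i ∧ (postM n w).alloc v i ≤ 1 := by
      intro i
      simp only [postM]
      split_ifs <;> simp
    refine ⟨h1, ?_⟩
    by_cases hk : ∃ k, w ≤ v k ∧ ∀ j, j < k → v j < w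
    · obtain ⟨k, hk⟩ := hk
      rw [Finset.sum_eq_single k]
      · exact (h1 k).2
      · intro i _ hi
        simp only [postM]
        rw [if_neg]
        rintro ⟨a, b⟩
        rcases lt_or_gt_of_ne hi with h | h
        · exact absurd (hk.2 i h) (not_lt.2 a)
        · exact absurd (b k h) (not_lt.2 hk.1)
      · simp
    · have : ∀ i, (postM n w).alloc v i = 0 := by
        intro i
        simp only [postM]
        exact if_neg fun h => hk ⟨i, h⟩
      simp [this]
  · intro i v hv s hs
    simp only [postM, Function.update_self, post_upd]
    split_ifs with h1 h2 h2
    · exact le_rfl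
    · have : ¬ w ≤ v i := fun h => h2 ⟨h, h1.2⟩
      linarith
    · linarith [h2.1]
    · exact le_rfl
  · intro v hv i
    simp only [postM]
    split_ifs with h
    · linarith [h.1]
    · simp
  · intro i
    exact Measurable.ite (post_set_meas w i) measurable_const measurable_const
  · intro i
    exact Measurable.ite (post_set_meas w i) measurable_const measurable_const
  · intro v i
    simp only [postM]
    split_ifs
    · exact hw.le
    · exact le_rfl
  · intro v i
    simp only [postM]
    split_ifs
    · exact le_rfl
    · exact hw.le

open Classical in
lemma step3 {w O ε : ℝ} (hw : 0 < w) (hε1 : ε < 1)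
    (hO : ∀ M : Mech n, M.Good → Rev M (Measure.pi D) ≤ O) (hOw : O ≤ ε * w) :
    (∀ i, (D i).real (Set.Ici w) ≤ ε) ∧
      w * (∑ i, (D i).real (Set.Ici w)) * (1 - ε) ≤ O := by
  have hN := post_nice (n := n) w hw
  have hR := hO _ hN.good
  rw [rev_eq_sum D hN] at hR
  set E : Set (Fin n → ℝ) := {v | ∃ j, w ≤ v j} with hE
  have hEm : MeasurableSet E := by
    have : E = ⋃ j, {v | w ≤ v j} := by ext v; simp [hE]
    rw [this]
    exact MeasurableSet.iUnion fun j =>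
      measurableSet_le measurable_const (measurable_pi_apply j)
  have hi : ∀ i, Integrable (fun v => (postM n w).pay v i) (Measure.pi D) := fun i =>
    int_of_bdd _ (hN.good.2.2.2.2 i) w fun v => by
      rw [abs_of_nonneg (hN.nonneg v i)]; exact hN.le v i
  have hPE : (Measure.pi D).real E * w ≤ O := by
    refine le_trans ?_ hR
    rw [← integral_finsetSum _ fun i _ => hi i, ← smul_eq_mul, ← integral_indicator_const _ hEm]
    refine integral_mono ((integrable_const _).indicator hEm)
      (integrable_finsetSum _ fun i _ => hi i) fun v => ?_
    by_cases hv : v ∈ E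
    · rw [Set.indicator_of_mem hv]
      have hne : (Finset.univ.filter fun j => w ≤ v j).Nonempty := by
        obtain ⟨j, hj⟩ := hv
        exact ⟨j, by simpa using hj⟩
      obtain ⟨k, hk, hmin⟩ := Finset.exists_min_image _ id hne
      refine le_trans ?_ (Finset.single_le_sum (fun j _ => hN.nonneg v j) (Finset.mem_univ k))
      simp only [postM]
      rw [if_pos]
      refine ⟨by simpa using hk, fun j hj => ?_⟩
      by_contra hc
      have := hmin j (by simpa using hc)
      exact absurd hj (not_lt.2 this)
    · rw [Set.indicator_of_notMem hv]
      exact Finset.sum_nonneg fun j _ => hN.nonneg v j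
  have hPE' : (Measure.pi D).real E ≤ ε := by
    have := hPE.trans hOw
    exact le_of_mul_le_mul_right this hw
  constructor
  · intro i
    refine le_trans ?_ hPE'
    have h1 := (measurePreserving_eval D i).measureReal_preimage
      (measurableSet_Ici (a := w)).nullMeasurableSet
    rw [← h1]
    exact measureReal_mono fun v hv => ⟨i, hv⟩
  · refine le_trans ?_ hR
    rw [Finset.mul_sum, Finset.sum_mul]
    refine Finset.sum_le_sum fun i _ => ?_
    rw [int_upd D i (hN.good.2.2.2.2 i) w (fun v => by
      rw [abs_of_nonneg (hN.nonneg v i)]; exact hN.le v i)]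
    have e : ∀ v : Fin n → ℝ, ∫ t, (postM n w).pay (Function.update v i t) i ∂(D i) =
        (PreLow w i).indicator (fun _ => w * (D i).real (Set.Ici w)) v := by
      intro v
      simp only [postM, Function.update_self, post_upd]
      by_cases h : ∀ j, j < i → v j < w
      · rw [Set.indicator_of_mem (show v ∈ PreLow w i from h)]
        have : ∀ t : ℝ, (if w ≤ t ∧ ∀ j, j < i → v j < w then w else 0) =
            (Set.Ici w).indicator (fun _ => w) t := by
          intro t
          by_cases ht : w ≤ t
          · rw [if_pos ⟨ht, h⟩, Set.indicator_of_mem (Set.mem_Ici.2 ht)]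
          · rw [if_neg (fun hc => ht hc.1), Set.indicator_of_notMem (by simpa using ht)]
        rw [integral_congr_ae (Filter.Eventually.of_forall this),
          integral_indicator_const _ measurableSet_Ici, smul_eq_mul, mul_comm]
      · rw [Set.indicator_of_notMem (show v ∉ PreLow w i from h)]
        simp only [h, and_false, if_false, integral_zero]
    simp only [e]
    rw [integral_indicator_const _ (preLow_meas w i), smul_eq_mul, mul_comm]
    refine mul_le_mul_of_nonneg_right ?_ (mul_nonneg hw.le measureReal_nonneg)
    have h2 : (Measure.pi D).real Eᶜ = 1 - (Measure.pi D).real E :=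
      probReal_compl_eq_one_sub hEm
    have h3 : (Measure.pi D).real Eᶜ ≤ (Measure.pi D).real (PreLow w i) :=
      measureReal_mono fun v hv j _ => by
        by_contra hc
        exact hv ⟨j, not_lt.1 hc⟩
    linarith

lemma clamp_limit (hnonneg : ∀ i, D i (Set.Iio 0) = 0) {M : Mech n} (hM : M.Good) {B : ℝ}
    (hB : ∀ T : ℝ, 0 ≤ T → Rev (clampM M T) (Measure.pi D) ≤ B) :
    Rev M (Measure.pi D) ≤ B := by
  have hcl := fun (T : ℝ) hT => clamp_nice hM T hT
  by_cases hintg : Integrable (fun v => ∑ i, M.pay v i) (Measure.pi D)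
  · set f := fun v => ∑ i, M.pay v i with hf
    set g : ℕ → (Fin n → ℝ) → ℝ := fun k v => ∑ i, (clampM M k).pay v i with hg
    have hgn : ∀ k v, 0 ≤ g k v := fun k v =>
      Finset.sum_nonneg fun i _ => (hcl k (Nat.cast_nonneg k)).nonneg v i
    have hgm : ∀ k, Measurable (g k) := fun k =>
      Finset.measurable_sum _ fun i _ => (hcl k (Nat.cast_nonneg k)).good.2.2.2.2 i
    have hfm : Measurable f := Finset.measurable_sum _ fun i _ => hM.2.2.2.2 i
    have hgi : ∀ k, Integrable (g k) (Measure.pi D) := fun k =>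
      integrable_finsetSum _ fun i _ => int_of_bdd _
        ((hcl k (Nat.cast_nonneg k)).good.2.2.2.2 i) k fun v => by
          rw [abs_of_nonneg ((hcl k (Nat.cast_nonneg k)).nonneg v i)]
          exact (hcl k (Nat.cast_nonneg k)).le v i
    have hlim : Filter.Tendsto (fun k => ∫ v, min (f v) (g k v) ∂(Measure.pi D)) Filter.atTop
        (nhds (∫ v, f v ∂(Measure.pi D))) := by
      refine tendsto_integral_of_dominated_convergence (fun v => |f v|)
        (fun k => (hfm.min (hgm k)).aestronglyMeasurable) hintg.abs ?_ ?_
      · intro k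
        refine Filter.Eventually.of_forall fun v => ?_
        rw [Real.norm_eq_abs]
        rcases le_total (f v) (g k v) with h | h
        · rw [min_eq_left h]
        · rw [min_eq_right h, abs_of_nonneg (hgn k v)]
          exact h.trans (le_abs_self _)
      · filter_upwards [ae_nonneg' D hnonneg] with v hv
        refine tendsto_const_nhds.congr' ?_
        have hev : ∀ᶠ k : ℕ in Filter.atTop, ∀ j, v j ≤ k := by
          rw [Filter.eventually_all]
          intro j
          obtain ⟨N, hN⟩ := exists_nat_ge (v j)
          filter_upwards [Filter.eventually_ge_atTop N] with k hk
          exact hN.trans (by exact_mod_cast hk)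
        filter_upwards [hev] with k hk
        have hc : clv (k : ℝ) v = v := by
          funext j; exact cl_of _ _ (hv j) (hk j)
        refine (min_eq_left (Finset.sum_le_sum fun i _ => ?_)).symm
        simp only [clampM, hc]
        have := hM.2.2.1 (Function.update v i 0) (upd_nonneg hv i le_rfl) i
        simp only [Function.update_self] at this
        linarith
    refine le_of_tendsto hlim (Filter.Eventually.of_forall fun k => ?_)
    refine le_trans (integral_mono (hintg.inf (hgi k)) (hgi k) fun v => min_le_right _ _) ?_
    exact hB k (Nat.cast_nonneg k)
  · have : Rev M (Measure.pi D) = 0 := integral_undef hintg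
    rw [this]
    refine le_trans ?_ (hB 0 le_rfl)
    exact integral_nonneg fun v => Finset.sum_nonneg fun i _ => (hcl 0 le_rfl).nonneg v i

def zeroM (n : ℕ) : Mech n := ⟨fun _ _ => 0, fun _ _ => 0⟩

lemma zero_good : (zeroM n).Good := by
  refine ⟨fun v => ⟨fun i => by simp [zeroM], by simp [zeroM]⟩, ?_, ?_, ?_, ?_⟩
  · intro i v _ s _; simp [zeroM]
  · intro v _ i; simp [zeroM]
  · intro i; simp [zeroM]
  · intro i; simp [zeroM]

lemma opt_nonneg (μ : Measure (Fin n → ℝ)) : 0 ≤ Opt μ := by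
  unfold Opt
  have hmem : (0:ℝ) ∈ {r : ℝ | ∃ M : Mech n, M.Good ∧ r = Rev M μ} :=
    ⟨zeroM n, zero_good, by simp [Rev, zeroM]⟩
  by_cases h : BddAbove {r : ℝ | ∃ M : Mech n, M.Good ∧ r = Rev M μ}
  · exact le_csSup h hmem
  · rw [Real.sSup_of_not_bddAbove h]

lemma trunc_bdd (hnonneg : ∀ i, D i (Set.Iio 0) = 0) (w : ℝ) (hw : 0 < w) :
    BddAbove {r : ℝ | ∃ M : Mech n, M.Good ∧ r = Rev M
      (Measure.pi fun i => Measure.map (fun v : ℝ => min v w) (D i))} := by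
  refine ⟨w, ?_⟩
  rintro r ⟨M, ⟨hV, -, hI, hm⟩, rfl⟩
  have hmm : Measurable (fun v : ℝ => min v w) := by fun_prop
  have : ∀ i, IsProbabilityMeasure (Measure.map (fun v : ℝ => min v w) (D i)) := fun i =>
    Measure.isProbabilityMeasure_map hmm.aemeasurable
  rw [← Measure.pi_map_pi (fun i => hmm.aemeasurable)]
  unfold Rev
  rw [integral_map (Measurable.aemeasurable (by fun_prop))
    (Finset.measurable_sum _ fun i _ => hm.2 i).aestronglyMeasurable]
  by_cases hintg : Integrable (fun v : Fin n → ℝ => ∑ i, M.pay (fun j => min (v j) w) i)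
    (Measure.pi D)
  · have h1 : ∫ v : Fin n → ℝ, ∑ i, M.pay (fun j => min (v j) w) i ∂(Measure.pi D) ≤
        ∫ v : Fin n → ℝ, w ∂(Measure.pi D) := by
      refine integral_mono_ae hintg (integrable_const _) ?_
      filter_upwards [ae_nonneg' D hnonneg] with v hv
      have h2 := hI (fun j => min (v j) w) (fun j => le_min (hv j) hw.le)
      have h3 := hV (fun j => min (v j) w)
      calc ∑ i, M.pay (fun j => min (v j) w) i
          ≤ ∑ i, w * M.alloc (fun j => min (v j) w) i := by
            refine Finset.sum_le_sum fun i _ => ?_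
            have a := h2 i
            have b := mul_le_mul_of_nonneg_right (min_le_right (v i) w) (h3.1 i).1
            linarith
        _ = w * ∑ i, M.alloc (fun j => min (v j) w) i := by rw [Finset.mul_sum]
        _ ≤ w := by nlinarith [h3.2]
    simpa using h1
  · rw [integral_undef hintg]; exact hw.le

end Final

/-- **Truncation lemma for regular distributions.** For `ε ∈ (0,1/4]`, a
regular product distribution `D` on `[0,∞)ⁿ`, and a truncation point
`v̄ ≥ (1/ε)·Opt(D)`, truncating every coordinate at `v̄` loses at most a `4ε`
fraction of the optimal revenue. -/
theorem truncation_regular {n : ℕ} (hn : 1 ≤ n)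
    (ε : ℝ) (hε : ε ∈ Set.Ioc (0 : ℝ) (1 / 4))
    (D : Fin n → Measure ℝ)
    (hprob : ∀ i, IsProbabilityMeasure (D i))
    (hnonneg : ∀ i, D i (Set.Iio 0) = 0)
    (hreg : ∀ i, Regular (D i))
    (vbar : ℝ) (hvbar : (1 / ε) * Opt (Measure.pi D) ≤ vbar) :
    (1 - 4 * ε) * Opt (Measure.pi D) ≤
      Opt (Measure.pi fun i => Measure.map (fun v : ℝ => min v vbar) (D i)) := by
  classical
  obtain ⟨hε0, hε4⟩ := hε
  set O := Opt (Measure.pi D) with hOdef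
  have hO0 : 0 ≤ O := opt_nonneg _
  rcases hO0.eq_or_lt with hz | hOpos
  · rw [← hz, mul_zero]; exact opt_nonneg _
  have hw : 0 < vbar := lt_of_lt_of_le (by positivity) hvbar
  have hOw : O ≤ ε * vbar := by
    rw [one_div, inv_mul_le_iff₀ hε0] at hvbar
    exact hvbar
  have hne : {r : ℝ | ∃ M : Mech n, M.Good ∧ r = Rev M (Measure.pi D)}.Nonempty :=
    ⟨_, zeroM n, zero_good, rfl⟩
  have hbdd : BddAbove {r : ℝ | ∃ M : Mech n, M.Good ∧ r = Rev M (Measure.pi D)} := by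
    by_contra h
    have : O = 0 := Real.sSup_of_not_bddAbove h
    linarith
  have hO : ∀ M : Mech n, M.Good → Rev M (Measure.pi D) ≤ O := fun M hM =>
    le_csSup hbdd ⟨M, hM, rfl⟩
  obtain ⟨hqε, hqsum⟩ := step3 D hw (by linarith) hO hOw
  set B := Opt (Measure.pi fun i => Measure.map (fun v : ℝ => min v vbar) (D i)) with hB
  suffices h : O ≤ B + 4 * ε * O by linarith
  refine csSup_le hne ?_
  rintro r ⟨M, hM, rfl⟩
  refine clamp_limit D hnonneg hM fun T hT => ?_
  have hN := clamp_nice hM T hT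
  have hcap := clamp_cap M T hT
  set M' := clampM M T
  have hbar : Rev (barM M' vbar) (Measure.pi D) ≤ B := by
    rw [← rev_trunc D hN hw]
    exact le_csSup (trunc_bdd D hnonneg vbar hw) ⟨_, (bar_nice hN hw).good, rfl⟩
  rw [rev_eq_sum D (bar_nice hN hw)] at hbar
  rw [rev_eq_sum D hN]
  have hT0 : ∀ v i, |M'.pay v i| ≤ T := fun v i => by
    rw [abs_of_nonneg (hN.nonneg v i)]; exact hN.le v i
  have hsplit : ∀ i, ∫ v, M'.pay v i ∂(Measure.pi D) =
      ∫ v, (if Bd vbar i v then M'.pay v i else 0) ∂(Measure.pi D) +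
      ∫ v, (if Bd vbar i v then 0 else M'.pay v i) ∂(Measure.pi D) := by
    intro i
    rw [← integral_add]
    · refine integral_congr_ae (Filter.Eventually.of_forall fun v => ?_)
      dsimp only
      split_ifs <;> simp
    · refine int_of_bdd _ (Measurable.ite (Bd_meas vbar i) (hN.good.2.2.2.2 i)
        measurable_const) T fun v => ?_
      split_ifs
      · exact hT0 v i
      · simpa using hT
    · refine int_of_bdd _ (Measurable.ite (Bd_meas vbar i) measurable_const
        (hN.good.2.2.2.2 i)) T fun v => ?_
      split_ifs
      · simpa using hT
      · exact hT0 v i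
  have h1 := step1 D hN hw hO
  have h2 : ∀ i, ∫ v, (if Bd vbar i v then 0 else M'.pay v i) ∂(Measure.pi D) ≤
      ∫ v, (barM M' vbar).pay v i ∂(Measure.pi D) +
        ε / (1 - ε) * (vbar * (D i).real (Set.Ici vbar)) := by
    intro i
    have hq := hqε i
    have hq0 : 0 ≤ (D i).real (Set.Ici vbar) := measureReal_nonneg
    refine (step2 D hnonneg hreg hN hw hcap i (by linarith)).trans ?_
    generalize (D i).real (Set.Ici vbar) = q at *
    have : vbar * q / (1 - q) - vbar * q ≤ ε / (1 - ε) * (vbar * q) := by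
      have e : vbar * q / (1 - q) - vbar * q = q / (1 - q) * (vbar * q) := by
        have : 1 - q ≠ 0 := by linarith
        field_simp; ring
      rw [e]
      refine mul_le_mul_of_nonneg_right ?_ (by positivity)
      exact div_le_div₀ hε0.le hq (by linarith) (by linarith)
    linarith
  rw [Finset.sum_congr rfl fun i _ => hsplit i, Finset.sum_add_distrib]
  have h3 := Finset.sum_le_sum fun i (_ : i ∈ Finset.univ) => h2 i
  rw [Finset.sum_add_distrib, ← Finset.mul_sum, ← Finset.mul_sum] at h3
  have hs0 : 0 ≤ ∑ i, (D i).real (Set.Ici vbar) := Finset.sum_nonneg fun i _ => measureReal_nonneg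
  set s := ∑ i, (D i).real (Set.Ici vbar)
  have h4 : ε / (1 - ε) ≤ 4 / 3 * ε := by
    rw [div_le_iff₀ (by linarith)]; nlinarith
  have h5 : vbar * s ≤ 4 / 3 * O := by nlinarith [mul_nonneg hw.le hs0]
  have h6 : s ≤ 4 / 3 * ε := by
    have : vbar * s ≤ vbar * (4 / 3 * ε) := by nlinarith
    exact le_of_mul_le_mul_left this hw
  have h7 : s * O ≤ 4 / 3 * ε * O := mul_le_mul_of_nonneg_right h6 hO0
  have h8 : ε / (1 - ε) * (vbar * s) ≤ 4 / 3 * ε * (4 / 3 * O) :=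
    mul_le_mul h4 h5 (mul_nonneg hw.le hs0) (by positivity)
  nlinarith [mul_pos hε0 hOpos]
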